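/- Let β > 0, let k = 3/(3+β), and let f₊₋(x,y,z) = β(x²y²+y²z²+z²x²) + (x²+y²+z²−1/2)² − (1−k)/4. Then the set of singular points of the quartic Q⁺⁻(k) = {f₊₋ = 0}, that is, the set of points at which f₊₋ and all three of its partial derivatives vanish, is exactly the set of eight points (ε₁t, ε₂t, ε₃t) with ε₁, ε₂, ε₃ ∈ {−1,1} and t = 1/√(2(β+3)) (the vertices of a cube centered at the origin). -/

import Mathlib

/-- The quartic polynomial `β·v + (u - 1/2)² - (1-k)/4` defining `Q⁺⁻(k)`. -/
noncomputable def fPM (β k : ℝ) (p : EuclideanSpace ℝ (Fin 3)) : ℝ :=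
  β * ((p 0)^2*(p 1)^2 + (p 1)^2*(p 2)^2 + (p 2)^2*(p 0)^2)
    + ((p 0)^2 + (p 1)^2 + (p 2)^2 - 1/2)^2 - (1 - k)/4

/-- The derivative of `fPM`, as a continuous linear functional. -/
theorem hasFDerivAt_fPM (β k : ℝ) (p : EuclideanSpace ℝ (Fin 3)) :
    HasFDerivAt (fPM β k)
      ((2 * (p 0 * (β * ((p 1)^2 + (p 2)^2) + 2 * ((p 0)^2 + (p 1)^2 + (p 2)^2) - 1))) •
          (EuclideanSpace.proj 0 : EuclideanSpace ℝ (Fin 3) →L[ℝ] ℝ)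
        + (2 * (p 1 * (β * ((p 2)^2 + (p 0)^2) + 2 * ((p 0)^2 + (p 1)^2 + (p 2)^2) - 1))) •
          (EuclideanSpace.proj 1 : EuclideanSpace ℝ (Fin 3) →L[ℝ] ℝ)
        + (2 * (p 2 * (β * ((p 0)^2 + (p 1)^2) + 2 * ((p 0)^2 + (p 1)^2 + (p 2)^2) - 1))) •
          (EuclideanSpace.proj 2 : EuclideanSpace ℝ (Fin 3) →L[ℝ] ℝ)) p := by
  have h (i : Fin 3) : HasFDerivAt (fun q : EuclideanSpace ℝ (Fin 3) => (q i)^2)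
      ((2 * p i) • (EuclideanSpace.proj i : EuclideanSpace ℝ (Fin 3) →L[ℝ] ℝ)) p := by
    simpa using
      (EuclideanSpace.proj i : EuclideanSpace ℝ (Fin 3) →L[ℝ] ℝ).hasFDerivAt.pow (x := p) 2
  have hv := ((((h 0).mul (h 1)).add ((h 1).mul (h 2))).add ((h 2).mul (h 0))).const_mul β
  have hu := ((((h 0).add (h 1)).add (h 2)).sub_const (1/2)).pow 2
  refine ((hv.add hu).sub_const ((1 - k)/4)).congr_fderiv ?_
  ext q
  simp
  ring

theorem smul_proj_add_eq_zero_iff (a b c : ℝ) :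
    a • (EuclideanSpace.proj 0 : EuclideanSpace ℝ (Fin 3) →L[ℝ] ℝ)
        + b • (EuclideanSpace.proj 1 : EuclideanSpace ℝ (Fin 3) →L[ℝ] ℝ)
        + c • (EuclideanSpace.proj 2 : EuclideanSpace ℝ (Fin 3) →L[ℝ] ℝ) = 0 ↔
      a = 0 ∧ b = 0 ∧ c = 0 := by
  constructor
  · intro h
    have h0 := DFunLike.congr_fun h !₂[1, 0, 0]
    have h1 := DFunLike.congr_fun h !₂[0, 1, 0]
    have h2 := DFunLike.congr_fun h !₂[0, 0, 1]
    simp at h0 h1 h2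
    exact ⟨h0, h1, h2⟩
  · rintro ⟨rfl, rfl, rfl⟩
    simp

theorem fderiv_fPM_eq_zero_iff (β k : ℝ) (p : EuclideanSpace ℝ (Fin 3)) :
    fderiv ℝ (fPM β k) p = 0 ↔
      p 0 * (β * ((p 1)^2 + (p 2)^2) + 2 * ((p 0)^2 + (p 1)^2 + (p 2)^2) - 1) = 0 ∧
      p 1 * (β * ((p 2)^2 + (p 0)^2) + 2 * ((p 0)^2 + (p 1)^2 + (p 2)^2) - 1) = 0 ∧
      p 2 * (β * ((p 0)^2 + (p 1)^2) + 2 * ((p 0)^2 + (p 1)^2 + (p 2)^2) - 1) = 0 := by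
  simp [(hasFDerivAt_fPM β k p).fderiv, smul_proj_add_eq_zero_iff]

/-- A critical point with a vanishing coordinate does not lie on the critical level set. -/
theorem critical_value_ne_of_last_eq_zero {β x y : ℝ} (hβ : 0 < β)
    (hx : x * (β * y^2 + 2 * (x^2 + y^2) - 1) = 0)
    (hy : y * (β * x^2 + 2 * (x^2 + y^2) - 1) = 0) :
    4 * (3 + β) * (β * (x^2 * y^2) + (x^2 + y^2 - 1/2)^2) ≠ β := by
  intro hf
  rcases mul_eq_zero.1 hx with rfl | hx <;> rcases mul_eq_zero.1 hy with rfl | hy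
  · norm_num at hf
    linarith
  · have h : y^2 = 1/2 := by linarith
    rw [h] at hf
    norm_num at hf
    exact hβ.ne hf
  · have h : x^2 = 1/2 := by linarith
    rw [h] at hf
    norm_num at hf
    exact hβ.ne hf
  · have hxy : x^2 = y^2 := mul_left_cancel₀ hβ.ne' (by linarith)
    have hX : y^2 = 1/(β+4) := by
      rw [eq_div_iff (by positivity)]
      rw [hxy] at hx
      linarith
    rw [hxy, hX] at hf
    field_simp at hf
    nlinarith

theorem sq_eq_of_critical {β x y z : ℝ} (hβ : 0 < β)
    (hf : 4 * (3 + β) * (β * (x^2*y^2 + y^2*z^2 + z^2*x^2) + (x^2 + y^2 + z^2 - 1/2)^2) = β)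
    (hx : x * (β * (y^2 + z^2) + 2 * (x^2 + y^2 + z^2) - 1) = 0)
    (hy : y * (β * (z^2 + x^2) + 2 * (x^2 + y^2 + z^2) - 1) = 0)
    (hz : z * (β * (x^2 + y^2) + 2 * (x^2 + y^2 + z^2) - 1) = 0) :
    x^2 = 1 / (2*(β+3)) ∧ y^2 = 1 / (2*(β+3)) ∧ z^2 = 1 / (2*(β+3)) := by
  have hx0 : x ≠ 0 := by
    rintro rfl
    exact critical_value_ne_of_last_eq_zero (x := y) (y := z) hβ
      (by linear_combination hy) (by linear_combination hz) (by linear_combination hf)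
  have hy0 : y ≠ 0 := by
    rintro rfl
    exact critical_value_ne_of_last_eq_zero (x := x) (y := z) hβ
      (by linear_combination hx) (by linear_combination hz) (by linear_combination hf)
  have hz0 : z ≠ 0 := by
    rintro rfl
    exact critical_value_ne_of_last_eq_zero (x := x) (y := y) hβ
      (by linear_combination hx) (by linear_combination hy) (by linear_combination hf)
  have hx := (mul_eq_zero.1 hx).resolve_left hx0
  have hy := (mul_eq_zero.1 hy).resolve_left hy0
  have hz := (mul_eq_zero.1 hz).resolve_left hz0
  have hxy : x^2 = y^2 := mul_left_cancel₀ hβ.ne' (by linarith)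
  have hyz : y^2 = z^2 := mul_left_cancel₀ hβ.ne' (by linarith)
  have hZ : z^2 = 1 / (2*(β+3)) := by
    rw [eq_div_iff (by positivity)]
    rw [hxy, hyz] at hx
    linarith
  exact ⟨hxy.trans (hyz.trans hZ), hyz.trans hZ, hZ⟩

theorem fPM_eq_zero_iff {β : ℝ} (hβ : 0 < β) (p : EuclideanSpace ℝ (Fin 3)) :
    fPM β (3/(3+β)) p = 0 ↔
      4 * (3 + β) * (β * ((p 0)^2*(p 1)^2 + (p 1)^2*(p 2)^2 + (p 2)^2*(p 0)^2)
        + ((p 0)^2 + (p 1)^2 + (p 2)^2 - 1/2)^2) = β := by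
  have hk : (1 - 3/(3+β))/4 = β / (4 * (3 + β)) := by
    field_simp
    ring
  rw [fPM, hk, sub_eq_zero, eq_div_iff (by positivity), mul_comm]

/-- for `β > 0` and `k = 3/(3+β)`, the singular points of `Q⁺⁻(k)`
are the eight points `(±t, ±t, ±t)` with `t = 1/√(2(β+3))` (vertices of a cube). -/
theorem stmt_11 (β : ℝ) (hβ : 0 < β) (k : ℝ) (hk : k = 3/(3+β)) :
    {p : EuclideanSpace ℝ (Fin 3) |
        fPM β k p = 0 ∧ fderiv ℝ (fPM β k) p = 0} =
      {p : EuclideanSpace ℝ (Fin 3) | ∃ ε₁ ε₂ ε₃ : ℝ,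
        (ε₁ = 1 ∨ ε₁ = -1) ∧ (ε₂ = 1 ∨ ε₂ = -1) ∧ (ε₃ = 1 ∨ ε₃ = -1) ∧
        p 0 = ε₁ * (1 / Real.sqrt (2*(β+3))) ∧
        p 1 = ε₂ * (1 / Real.sqrt (2*(β+3))) ∧
        p 2 = ε₃ * (1 / Real.sqrt (2*(β+3)))} := by
  subst hk
  have ht : (1 / Real.sqrt (2*(β+3)))^2 = 1 / (2*(β+3)) := by
    rw [div_pow, one_pow, Real.sq_sqrt (by positivity)]
  ext p
  simp only [Set.mem_ofPred_eq, fPM_eq_zero_iff hβ, fderiv_fPM_eq_zero_iff]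
  constructor
  · rintro ⟨hf, h0, h1, h2⟩
    have sign {x : ℝ} (hx : x^2 = 1 / (2*(β+3))) :
        ∃ ε : ℝ, (ε = 1 ∨ ε = -1) ∧ x = ε * (1 / Real.sqrt (2*(β+3))) := by
      rcases sq_eq_sq_iff_eq_or_eq_neg.1 (hx.trans ht.symm) with h | h
      · exact ⟨1, .inl rfl, by rw [h, one_mul]⟩
      · exact ⟨-1, .inr rfl, by rw [h, neg_one_mul]⟩
    obtain ⟨hx, hy, hz⟩ := sq_eq_of_critical hβ hf h0 h1 h2
    obtain ⟨ε₁, hε₁, h₁⟩ := sign hx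
    obtain ⟨ε₂, hε₂, h₂⟩ := sign hy
    obtain ⟨ε₃, hε₃, h₃⟩ := sign hz
    exact ⟨ε₁, ε₂, ε₃, hε₁, hε₂, hε₃, h₁, h₂, h₃⟩
  · rintro ⟨ε₁, ε₂, ε₃, hε₁, hε₂, hε₃, h₁, h₂, h₃⟩
    have sq {x ε : ℝ} (hε : ε = 1 ∨ ε = -1) (hx : x = ε * (1 / Real.sqrt (2*(β+3)))) :
        x^2 = 1 / (2*(β+3)) := by
      rw [hx, mul_pow, ht, show ε^2 = 1 by rcases hε with rfl | rfl <;> norm_num, one_mul]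
    rw [sq hε₁ h₁, sq hε₂ h₂, sq hε₃ h₃]
    have hc : β * (1 / (2*(β+3)) + 1 / (2*(β+3)))
        + 2 * (1 / (2*(β+3)) + 1 / (2*(β+3)) + 1 / (2*(β+3))) - 1 = 0 := by
      field_simp
      ring
    refine ⟨?_, by rw [hc, mul_zero], by rw [hc, mul_zero], by rw [hc, mul_zero]⟩
    field_simp
    ring
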